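/- arXiv:2307.02969 — 3 statements merged into one kernel-verified Lean document; each statement's English description precedes it below -/
import Mathlib

section
/- Let A be a finite multiset of real numbers with at least two elements and let A' = A + {x} be obtained from A by inserting one additional real number x. Write gaps(A) for the multiset of consecutive differences x_{(i+1)} − x_{(i)} of the sorted enumeration x_{(0)} ≤ … ≤ x_{(|A|−1)} of A. Then for every threshold v ∈ ℝ, the number of elements of gaps(A) that are ≤ v and the number of elements of gaps(A') that are ≤ v differ by at most 2. Consequently, the rank of any fixed value within the sorted list of consecutive gaps changes by at most two when one data point is added, so the exponential-mechanism percentile algorithm applied to neighbouring-point distances has sensitivity 2. -/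
/-- The multiset of consecutive differences (gaps between neighbouring data points)
of the sorted enumeration of a finite multiset of reals. -/
noncomputable def gaps (A : Multiset ℝ) : List ℝ :=
  let l := A.sort (· ≤ ·)
  List.zipWith (fun a b => b - a) l l.tail

/-- Inserting one element at any position of a list changes the number of consecutive
differences that satisfy `g ≤ v` by at most 2. -/
theorem abs_length_filter_zipWith_insert_sub_le (x v : ℝ) (l₁ l₂ : List ℝ) :
    |((((List.zipWith (fun a b => b - a) (l₁ ++ x :: l₂) (l₁ ++ x :: l₂).tail).filter
        (fun g => g ≤ v)).length : ℤ) -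
      (((List.zipWith (fun a b => b - a) (l₁ ++ l₂) (l₁ ++ l₂).tail).filter
        (fun g => g ≤ v)).length : ℤ))| ≤ 2 := by
  induction l₁ with
  | nil =>
    cases l₂ with
    | nil => simp
    | cons b t =>
      simp only [List.nil_append, List.tail_cons, List.zipWith_cons_cons, List.filter_cons]
      rw [abs_le]
      split_ifs <;> push_cast [List.length_cons] <;> constructor <;> linarith
  | cons a l ih =>
    cases l with
    | nil =>
      cases l₂ with
      | nil =>
        simp only [List.nil_append, List.cons_append, List.tail_cons, List.zipWith_cons_cons,
          List.filter_cons, List.zipWith_nil_right]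
        split_ifs <;> simp
      | cons b t =>
        simp only [List.nil_append, List.cons_append, List.tail_cons, List.zipWith_cons_cons,
          List.filter_cons]
        rw [abs_le]
        split_ifs <;> push_cast [List.length_cons] <;> constructor <;> linarith
    | cons c t =>
      simp only [List.cons_append, List.tail_cons, List.zipWith_cons_cons,
        List.filter_cons (x := c - a)] at ih ⊢
      split_ifs
      · simpa only [List.length_cons, Nat.cast_succ, add_sub_add_right_eq_sub] using ih
      · exact ih

/-- The sorted enumeration of `x ::ₘ A` arises from that of `A` by inserting `x` somewhere. -/
theorem exists_sort_cons_eq_append (A : Multiset ℝ) (x : ℝ) :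
    ∃ l₁ l₂ : List ℝ, A.sort (· ≤ ·) = l₁ ++ l₂ ∧ (x ::ₘ A).sort (· ≤ ·) = l₁ ++ x :: l₂ := by
  have h : (x ::ₘ A).sort (· ≤ ·) = (A.sort (· ≤ ·)).orderedInsert (· ≤ ·) x := by
    refine List.Perm.eq_of_pairwise' (Multiset.pairwise_sort _ _)
      ((Multiset.pairwise_sort A _).orderedInsert x _) ?_
    rw [← Multiset.coe_eq_coe, Multiset.sort_eq,
      Multiset.coe_eq_coe.mpr (List.perm_orderedInsert _ _ _), ← Multiset.cons_coe,
      Multiset.sort_eq]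
  exact ⟨_, _, List.takeWhile_append_dropWhile.symm,
    h.trans (List.orderedInsert_eq_take_drop _ _ _)⟩

/-- Adding one data point to a multiset of reals changes the number of
consecutive gaps that are `≤ v` by at most 2 (sensitivity-2 of the
percentile algorithm applied to neighbouring-point distances). -/
theorem gaps_rank_sensitivity_two (A : Multiset ℝ) (hA : 2 ≤ Multiset.card A)
    (x : ℝ) (v : ℝ) :
    |((((gaps (x ::ₘ A)).filter (fun g => g ≤ v)).length : ℤ) -
      (((gaps A).filter (fun g => g ≤ v)).length : ℤ))| ≤ 2 := by
  obtain ⟨l₁, l₂, h₁, h₂⟩ := exists_sort_cons_eq_append A x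
  simp only [gaps, h₁, h₂]
  exact abs_length_filter_zipWith_insert_sub_le x v l₁ l₂
end

section
/- Let t, q be valid centreness parameters (0 < 2q ≤ t ≤ 1 and q < 1/2) and let ñ > 0. Then the centreness function c : [0, ñ] → ℝ, defined by c(r) = t·(ñ/2 − |r − ñ/2|)/(ñ·q) for r ∈ [0, ñ·q] ∪ [ñ − ñ·q, ñ] and c(r) = (t − 2q)/(1 − 2q) + (1 − t)·(ñ/2 − |r − ñ/2|)/(ñ/2 − ñ·q) otherwise, is Lipschitz continuous on [0, ñ] with Lipschitz constant t/(ñ·q); that is, for all r, r' ∈ [0, ñ], |c(r) − c(r')| ≤ (t/(ñ·q))·|r − r'|. -/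
/-- The centreness function with parameters `t`, `q` and noisy count `n`:
`c(r) = t·(n/2 − |r − n/2|)/(n·q)` on the outer quantiles
`[0, nq] ∪ [n − nq, n]`, and
`c(r) = (t − 2q)/(1 − 2q) + (1 − t)·(n/2 − |r − n/2|)/(n/2 − nq)`
on the inner quantile. -/
noncomputable def centreness (t q n : ℝ) (r : ℝ) : ℝ :=
  if r ≤ n * q ∨ n - n * q ≤ r then
    t * (n / 2 - |r - n / 2|) / (n * q)
  else
    (t - 2 * q) / (1 - 2 * q) + (1 - t) * (n / 2 - |r - n / 2|) / (n / 2 - n * q)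

/-- The centreness function is a nonnegative combination of the depth `n/2 − |r − n/2|` of `r`
and this depth truncated at `n·q`. -/
theorem centreness_eq_add_min (t q n : ℝ) (hq : 0 < q) (hq2 : q < 1 / 2) (hn : 0 < n) (r : ℝ) :
    centreness t q n r = (1 - t) / (n / 2 - n * q) * (n / 2 - |r - n / 2|) +
      (t / (n * q) - (1 - t) / (n / 2 - n * q)) * min (n / 2 - |r - n / 2|) (n * q) := by
  have hgap : 0 < 1 - 2 * q := by linarith
  have hiff : (r ≤ n * q ∨ n - n * q ≤ r) ↔ n / 2 - |r - n / 2| ≤ n * q := by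
    rw [sub_le_comm (c := n * q) (a := n / 2), le_abs']
    constructor <;> rintro (h | h)
    · left; linarith
    · right; linarith
    · left; linarith
    · right; linarith
  unfold centreness
  by_cases h : n / 2 - |r - n / 2| ≤ n * q
  · rw [if_pos (hiff.2 h), min_eq_left h]
    ring
  · rw [if_neg (mt hiff.1 h), min_eq_right (not_le.1 h).le]
    have hfac : n / 2 - n * q = n * (1 - 2 * q) / 2 := by ring
    rw [hfac]
    field_simp
    ring

/-- The slope of the centreness function on the inner quantile is at most its slope on the outer
quantiles. -/
theorem centreness_inner_slope_le (t q n : ℝ) (hq : 0 < q) (htq : 2 * q ≤ t)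
    (hq2 : q < 1 / 2) (hn : 0 < n) :
    (1 - t) / (n / 2 - n * q) ≤ t / (n * q) := by
  have hgap : 0 < n / 2 - n * q := by nlinarith
  rw [div_le_div_iff₀ hgap (mul_pos hn hq)]
  nlinarith [mul_le_mul_of_nonneg_left htq hn.le]

/-- The centreness function with valid parameters is Lipschitz on `[0, n]`
with Lipschitz constant `t/(n·q)`. -/
theorem centreness_lipschitz (t q n : ℝ) (hq : 0 < q) (htq : 2 * q ≤ t) (ht : t ≤ 1)
    (hq2 : q < 1 / 2) (hn : 0 < n) :
    ∀ r ∈ Set.Icc (0 : ℝ) n, ∀ r' ∈ Set.Icc (0 : ℝ) n,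
      |centreness t q n r - centreness t q n r'| ≤ t / (n * q) * |r - r'| := by
  intro r _ r' _
  have hgap : 0 < n / 2 - n * q := by nlinarith
  rw [centreness_eq_add_min t q n hq hq2 hn r, centreness_eq_add_min t q n hq hq2 hn r']
  have hs : 0 ≤ (1 - t) / (n / 2 - n * q) := div_nonneg (by linarith) hgap.le
  have hL := sub_nonneg.2 (centreness_inner_slope_le t q n hq htq hq2 hn)
  set s := (1 - t) / (n / 2 - n * q)
  set L := t / (n * q)
  have hd : |(n / 2 - |r - n / 2|) - (n / 2 - |r' - n / 2|)| ≤ |r - r'| := by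
    rw [sub_sub_sub_cancel_left, abs_sub_comm]
    simpa using abs_abs_sub_abs_le_abs_sub (r - n / 2) (r' - n / 2)
  set d := n / 2 - |r - n / 2|
  set d' := n / 2 - |r' - n / 2|
  have hm : |min d (n * q) - min d' (n * q)| ≤ |r - r'| := by
    refine (abs_min_sub_min_le_max d (n * q) d' (n * q)).trans ?_
    simpa using hd
  calc |s * d + (L - s) * min d (n * q) - (s * d' + (L - s) * min d' (n * q))|
      = |s * (d - d') + (L - s) * (min d (n * q) - min d' (n * q))| := by congr 1; ring
    _ ≤ s * |d - d'| + (L - s) * |min d (n * q) - min d' (n * q)| := by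
      refine (abs_add_le _ _).trans_eq ?_
      rw [abs_mul, abs_mul, abs_of_nonneg hs, abs_of_nonneg hL]
    _ ≤ s * |r - r'| + (L - s) * |r - r'| := by gcongr
    _ = L * |r - r'| := by ring
end

section
/- Let t, q be valid centreness parameters (0 < 2q ≤ t ≤ 1, q < 1/2), let ñ > 0 and let λ be a real with 0 ≤ λ < ñ. Let c : [0, ñ] → ℝ be the centreness function with parameters t, q and noisy count ñ. Then for all ranks r, r' ∈ [0, ñ] with |r − r'| ≤ 1, one has |c(r) − c(r')| ≤ t/((ñ − λ)·q). (Since adding a single data point to a set changes the rank of any split candidate by at most one, this bounds the sensitivity of the centreness subscore by t/((ñ − λ)q).) -/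
/-- The centreness function is the minimum of two affine functions of the distance
`n / 2 - |r - n / 2|` to the nearer end of `[0, n]`. -/
theorem centreness_eq_min {t q n : ℝ} (hq : 0 < q) (htq : 2 * q ≤ t) (hq2 : q < 1 / 2)
    (hn : 0 < n) (r : ℝ) :
    centreness t q n r =
      min (t / (n * q) * (n / 2 - |r - n / 2|))
        ((t - 2 * q) / (1 - 2 * q) + (1 - t) / (n / 2 - n * q) * (n / 2 - |r - n / 2|)) := by
  have hq' : 0 < 1 - 2 * q := by linarith
  have hnq : 0 < n / 2 - n * q := by nlinarith
  have houter : (r ≤ n * q ∨ n - n * q ≤ r) ↔ n / 2 - |r - n / 2| ≤ n * q := by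
    rw [sub_le_comm (b := |r - n / 2|), le_abs]
    constructor <;> rintro (h | h)
    · right; linarith
    · left; linarith
    · right; linarith
    · left; linarith
  have hdiff (d : ℝ) : (t - 2 * q) / (1 - 2 * q) + (1 - t) / (n / 2 - n * q) * d
      - t / (n * q) * d = (t - 2 * q) / ((1 - 2 * q) * (n * q)) * (n * q - d) := by
    have h : n / 2 - n * q = n * (1 - 2 * q) / 2 := by ring
    rw [h]
    field_simp
    ring
  have hcoef : 0 ≤ (t - 2 * q) / ((1 - 2 * q) * (n * q)) :=
    div_nonneg (by linarith) (by positivity)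
  have key := hdiff (n / 2 - |r - n / 2|)
  unfold centreness
  simp only [houter]
  split_ifs with h
  · rw [min_eq_left, div_mul_eq_mul_div]
    have := mul_nonneg hcoef (sub_nonneg.2 h)
    linarith
  · rw [min_eq_right, mul_div_right_comm]
    have := mul_nonpos_of_nonneg_of_nonpos hcoef (sub_nonpos.2 (not_le.1 h).le)
    linarith

/-- The centreness function is Lipschitz with constant `t / (n * q)`. -/
theorem abs_centreness_sub_le {t q n : ℝ} (hq : 0 < q) (htq : 2 * q ≤ t) (ht : t ≤ 1)
    (hq2 : q < 1 / 2) (hn : 0 < n) (r r' : ℝ) :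
    |centreness t q n r - centreness t q n r'| ≤ t / (n * q) * |r - r'| := by
  have hnq : 0 < n / 2 - n * q := by nlinarith
  have hA : 0 ≤ t / (n * q) := div_nonneg (by linarith) (by positivity)
  have hB : 0 ≤ (1 - t) / (n / 2 - n * q) := div_nonneg (by linarith) hnq.le
  have hBA : (1 - t) / (n / 2 - n * q) ≤ t / (n * q) := by
    rw [div_le_div_iff₀ hnq (by positivity)]
    nlinarith
  have hdist : |(n / 2 - |r - n / 2|) - (n / 2 - |r' - n / 2|)| ≤ |r - r'| := by
    have h := abs_abs_sub_abs_le_abs_sub (r' - n / 2) (r - n / 2)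
    rwa [sub_sub_sub_cancel_right, abs_sub_comm r' r, ← sub_sub_sub_cancel_left _ _ (n / 2)] at h
  rw [centreness_eq_min hq htq hq2 hn, centreness_eq_min hq htq hq2 hn]
  refine (abs_min_sub_min_le_max _ _ _ _).trans (max_le ?_ ?_)
  · rw [← mul_sub, abs_mul, abs_of_nonneg hA]
    gcongr
  · rw [add_sub_add_left_eq_sub, ← mul_sub, abs_mul, abs_of_nonneg hB]
    gcongr

/-- Sensitivity of the centreness subscore: if two ranks in `[0, n]` differ by
at most one, then the corresponding centreness values differ by at most
`t/((n − λ)·q)`. -/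
theorem centreness_sensitivity (t q n lam : ℝ) (hq : 0 < q) (htq : 2 * q ≤ t) (ht : t ≤ 1)
    (hq2 : q < 1 / 2) (hn : 0 < n) (hlam : 0 ≤ lam) (hlamn : lam < n) :
    ∀ r ∈ Set.Icc (0 : ℝ) n, ∀ r' ∈ Set.Icc (0 : ℝ) n, |r - r'| ≤ 1 →
      |centreness t q n r - centreness t q n r'| ≤ t / ((n - lam) * q) := by
  intro r _ r' _ hr
  have hpos : 0 < n - lam := sub_pos.2 hlamn
  have ht0 : 0 ≤ t := by linarith
  calc |centreness t q n r - centreness t q n r'|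
      ≤ t / (n * q) * |r - r'| := abs_centreness_sub_le hq htq ht hq2 hn r r'
    _ ≤ t / (n * q) := mul_le_of_le_one_right (by positivity) hr
    _ ≤ t / ((n - lam) * q) := by
      gcongr
      linarith
end
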